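/- Let p > 3 be a prime. Then ∑_{k=0}^{p-1} (2k+1) A_k(-1) ≡ (-1)^{(p-1)/2} p - p³ E_{p-3} (mod p⁴). -/

import Mathlib

/-- The Apéry polynomial `A_n(x) = ∑_{k=0}^n C(n,k)² C(n+k,k)² x^k`. -/
def aperyPoly (n : ℕ) (x : ℤ) : ℤ :=
  ∑ k ∈ Finset.range (n + 1), (n.choose k : ℤ) ^ 2 * ((n + k).choose k : ℤ) ^ 2 * x ^ k

/-- The Euler numbers: `E_0 = 1` and `∑_{0 ≤ k ≤ n, k even} C(n,k) E_{n-k} = 0` for `n ≥ 1`. -/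
def eulerNumber : ℕ → ℤ
  | 0 => 1
  | n + 1 =>
    -∑ j ∈ (Finset.range (n + 1)).attach,
      if Even (n + 1 - j.1) then ((n + 1).choose j.1 : ℤ) * eulerNumber j.1 else 0
  decreasing_by exact Finset.mem_range.mp j.2

open Finset Polynomial

theorem eulerNumber_sum_eq_zero (n : ℕ) (hn : 0 < n) :
    ∑ j ∈ range (n + 1), (if Even (n - j) then (n.choose j : ℤ) * eulerNumber j else 0) = 0 := by
  obtain ⟨m, rfl⟩ : ∃ m, n = m + 1 := ⟨n - 1, by omega⟩
  rw [sum_range_succ]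
  have h : eulerNumber (m + 1) = -∑ j ∈ range (m + 1),
      (if Even (m + 1 - j) then ((m + 1).choose j : ℤ) * eulerNumber j else 0) := by
    rw [eulerNumber, ← sum_attach (range (m + 1))]
  simp [h]

theorem eulerNumber_eq_zero_of_odd (n : ℕ) (hn : Odd n) : eulerNumber n = 0 := by
  induction n using Nat.strong_induction_on with
  | _ n ih =>
    have h := eulerNumber_sum_eq_zero n hn.pos
    rw [sum_range_succ, sum_eq_zero] at h
    · simpa using h
    · intro j hj
      have hj := mem_range.mp hj
      split_ifs with he
      · rw [ih j hj, mul_zero]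
        rw [Nat.even_sub hj.le] at he
        rw [← Nat.not_even_iff_odd] at hn ⊢
        tauto
      · rfl

/-- The umbral functional `X ^ j ↦ E_j`. -/
noncomputable def eulerFunctional (R : Type*) [CommRing R] : R[X] →ₗ[R] R :=
  (Polynomial.basisMonomials R).constr R fun j => (eulerNumber j : R)

section

variable {R : Type*} [CommRing R]

theorem eulerFunctional_X_pow (j : ℕ) :
    eulerFunctional R (X ^ j) = (eulerNumber j : R) := by
  have h := (Polynomial.basisMonomials R).constr_basis R (fun j => (eulerNumber j : R)) j
  simpa [eulerFunctional, coe_basisMonomials, monomial_one_right_eq_X_pow] using h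

theorem eulerFunctional_X_add_C_pow (x : R) (n : ℕ) :
    eulerFunctional R ((X + C x) ^ n) =
      ∑ j ∈ range (n + 1), x ^ (n - j) * (n.choose j : R) * (eulerNumber j : R) := by
  rw [add_pow, map_sum]
  refine sum_congr rfl fun j _ => ?_
  rw [← eulerFunctional_X_pow, ← smul_eq_mul (x ^ (n - j) * (n.choose j : R)), ← map_smul,
    smul_eq_C_mul]
  congr 1
  simp only [map_mul, map_pow, map_natCast]
  ring

theorem eulerFunctional_X_add_one_pow_add (n : ℕ) :
    eulerFunctional R ((X + 1) ^ n) + eulerFunctional R ((X - 1) ^ n) = 2 * 0 ^ n := by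
  have h1 := eulerFunctional_X_add_C_pow (1 : R) n
  have h2 := eulerFunctional_X_add_C_pow (-1 : R) n
  rw [map_neg, map_one, ← sub_eq_add_neg] at h2
  rw [map_one] at h1
  rw [h1, h2, ← sum_add_distrib]
  rcases Nat.eq_zero_or_pos n with rfl | hn
  · simp [eulerNumber]
    norm_num
  · have h := congrArg (fun z : ℤ => (2 : R) * z) (eulerNumber_sum_eq_zero n hn)
    rw [zero_pow hn.ne', mul_zero]
    simp only [Int.cast_zero, mul_zero] at h
    rw [← h, Int.cast_sum, mul_sum]
    refine sum_congr rfl fun j _ => ?_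
    split_ifs with he
    · rw [he.neg_one_pow]
      push_cast
      ring
    · rw [(Nat.not_even_iff_odd.mp he).neg_one_pow]
      simp

theorem eulerFunctional_comp_add (q : R[X]) :
    eulerFunctional R (q.comp (X + 1)) + eulerFunctional R (q.comp (X - 1)) = 2 * q.eval 0 := by
  induction q using Polynomial.induction_on' with
  | add q r hq hr =>
    simp only [add_comp, map_add, eval_add]
    linear_combination hq + hr
  | monomial n a =>
    have h := eulerFunctional_X_add_one_pow_add (R := R) n
    simp only [monomial_comp, ← smul_eq_C_mul, map_smul, smul_eq_mul, eval_monomial]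
    linear_combination a * h

theorem eulerFunctional_X_add_C_pow_recurrence (x : R) (n : ℕ) :
    eulerFunctional R ((X + C (x + 1)) ^ n) + eulerFunctional R ((X + C (x - 1)) ^ n) =
      2 * x ^ n := by
  have h := eulerFunctional_comp_add ((X + C x) ^ n)
  simp only [pow_comp, add_comp, X_comp, C_comp, eval_pow, eval_add, eval_X, eval_C,
    zero_add] at h
  rw [← h, map_add, map_sub, map_one]
  congr 3 <;> ring

theorem eulerFunctional_X_sub_one_pow (n : ℕ) (hn : 0 < n) (he : Even n) :
    eulerFunctional R ((X + C (-1)) ^ n) = 0 := by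
  have h := congrArg (fun z : ℤ => (z : R)) (eulerNumber_sum_eq_zero n hn)
  simp only [Int.cast_zero] at h
  rw [eulerFunctional_X_add_C_pow, ← h, Int.cast_sum]
  refine sum_congr rfl fun j hj => ?_
  have hj : j ≤ n := Nat.lt_succ_iff.mp (mem_range.mp hj)
  split_ifs with h'
  · rw [h'.neg_one_pow]
    push_cast
    ring
  · rw [eulerNumber_eq_zero_of_odd j]
    · simp
    · rw [Nat.even_sub hj] at h'
      rw [← Nat.not_even_iff_odd]
      tauto

theorem two_mul_sum_neg_one_pow_mul_odd_pow (n h : ℕ) :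
    ∑ k ∈ range h, 2 * ((-1 : R) ^ k * (2 * (k : R) + 1) ^ n) =
      eulerNumber n - (-1) ^ h * eulerFunctional R ((X + C (2 * (h : R))) ^ n) := by
  induction h with
  | zero => simp [eulerFunctional_X_pow]
  | succ h ih =>
    have key := eulerFunctional_X_add_C_pow_recurrence (2 * (h : R) + 1) n
    rw [sum_range_succ, ih]
    rw [show 2 * (h : R) + 1 + 1 = 2 * ((h + 1 : ℕ) : R) by push_cast; ring,
      show 2 * (h : R) + 1 - 1 = 2 * (h : R) by ring] at key
    rw [pow_succ]
    linear_combination -(-1 : R) ^ h * key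

end

theorem two_mul_sum_neg_one_pow_mul_odd_pow_modEq (p h : ℕ) (h1 : 1 < h) (hp : p = 2 * h + 1) :
    ∑ k ∈ range h, 2 * ((-1 : ℤ) ^ k * (2 * (k : ℤ) + 1) ^ (p - 3)) ≡ eulerNumber (p - 3)
      [ZMOD p] := by
  rw [← ZMod.intCast_eq_intCast_iff]
  push_cast
  rw [two_mul_sum_neg_one_pow_mul_odd_pow]
  have h2 : (2 * (h : ZMod p)) = -1 := by
    have := ZMod.natCast_self p
    rw [hp] at this ⊢
    push_cast at this
    linear_combination this
  rw [h2, eulerFunctional_X_sub_one_pow _ (by omega) ⟨h - 1, by omega⟩]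
  simp

theorem two_mul_add_one_mul_sum_choose_sq (N k : ℕ) :
    (2 * (k : ℤ) + 1) * ∑ n ∈ range N,
      (2 * (n : ℤ) + 1) * ((n.choose k : ℤ) ^ 2 * ((n + k).choose k : ℤ) ^ 2) =
      ((N : ℤ) - k) ^ 2 * ((N.choose k : ℤ) ^ 2 * ((N + k).choose k : ℤ) ^ 2) := by
  induction N with
  | zero => cases k <;> simp
  | succ N ih =>
    rw [sum_range_succ, mul_add, ih]
    have h1 : (((N + 1 : ℕ) : ℤ) - k) * ((N + 1).choose k : ℤ) = (N + 1) * (N.choose k : ℤ) := by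
      rcases le_or_gt k (N + 1) with hk | hk
      · have := Nat.choose_mul_succ_eq N k
        zify [hk] at this
        push_cast
        linear_combination -this
      · rw [Nat.choose_eq_zero_of_lt hk, Nat.choose_eq_zero_of_lt (by omega)]
        simp
    have h2 : ((N : ℤ) + 1) * ((N + 1 + k).choose k : ℤ) =
        (N + 1 + k) * ((N + k).choose k : ℤ) := by
      have := Nat.choose_mul_succ_eq (N + k) k
      rw [show N + k + 1 - k = N + 1 by omega, show N + k + 1 = N + 1 + k by ring] at this
      zify at this
      linear_combination -this
    have h3 : (((N + 1 : ℕ) : ℤ) - k) * ((N + 1).choose k : ℤ) * ((N + 1 + k).choose k : ℤ) =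
        (N + 1 + k) * (N.choose k * ((N + k).choose k : ℤ)) := by
      rw [h1]
      linear_combination (N.choose k : ℤ) * h2
    have h4 := congrArg (· ^ 2) h3
    linear_combination -h4

theorem sub_mul_choose_eq (p k : ℕ) (hk : k < p) :
    ((p : ℤ) - k) * (p.choose k : ℤ) = p * ((p - 1).choose k : ℤ) := by
  obtain ⟨m, rfl⟩ : ∃ m, p = m + 1 := ⟨p - 1, by omega⟩
  have := Nat.choose_mul_succ_eq m k
  zify [hk.le] at this
  push_cast
  linear_combination -this

theorem choose_mul_choose_succ (p k : ℕ) (hk : k + 1 < p) :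
    ((p - 1).choose (k + 1) * (p + (k + 1)).choose (k + 1) : ℤ) * ((k : ℤ) + 1) ^ 2 =
      ((p - 1).choose k * (p + k).choose k : ℤ) * ((p : ℤ) ^ 2 - (k + 1) ^ 2) := by
  have h1 := Nat.choose_succ_right_eq (p - 1) k
  have h2 := Nat.add_one_mul_choose_eq (p + k) k
  rw [show p + k + 1 = p + (k + 1) by ring] at h2
  zify [show k ≤ p - 1 by omega, show 1 ≤ p by omega] at h1 h2
  linear_combination ((p + (k + 1)).choose (k + 1) : ℤ) * (k + 1) * h1 -
    ((p - 1).choose k : ℤ) * (p - 1 - k) * h2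

theorem prime_dvd_pow_sub_one (p : ℕ) (hp : p.Prime) (a : ℤ) (ha : ¬ (p : ℤ) ∣ a) :
    (p : ℤ) ∣ a ^ (p - 1) - 1 := by
  have : Fact p.Prime := ⟨hp⟩
  rw [← ZMod.intCast_zmod_eq_zero_iff_dvd]
  push_cast
  rw [ZMod.pow_card_sub_one_eq_one, sub_self]
  rwa [Ne, ZMod.intCast_zmod_eq_zero_iff_dvd]

theorem choose_mul_choose_modEq (p k : ℕ) (hp : p.Prime) (h3 : 3 < p) (hk : k < p) :
    (p : ℤ) ^ 3 ∣ ((p - 1).choose k * (p + k).choose k : ℤ) -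
      (-1) ^ k * (1 - (p : ℤ) ^ 2 * ∑ j ∈ range k, ((j : ℤ) + 1) ^ (p - 3)) := by
  induction k with
  | zero => simp
  | succ k ih =>
    have hn : ¬ (p : ℤ) ∣ ((k : ℤ) + 1) := by
      intro h
      have : p ∣ k + 1 := by exact_mod_cast h
      exact absurd (Nat.le_of_dvd (by omega) this) (by omega)
    have hcop : IsCoprime ((p : ℤ) ^ 3) (((k : ℤ) + 1) ^ 2) :=
      (((Nat.prime_iff_prime_int.mp hp).coprime_iff_not_dvd).mpr hn).pow
    refine hcop.dvd_of_dvd_mul_right ?_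
    obtain ⟨a, ha⟩ := ih (by omega)
    obtain ⟨b, hb⟩ := prime_dvd_pow_sub_one p hp _ hn
    rw [show p - 1 = p - 3 + 2 by omega, pow_add] at hb
    have hc := choose_mul_choose_succ p k hk
    rw [sum_range_succ, sub_mul, hc, pow_succ]
    set S := ∑ j ∈ range k, ((j : ℤ) + 1) ^ (p - 3)
    refine ⟨a * ((p : ℤ) ^ 2 - (k + 1) ^ 2) - (-1) ^ k * b - (-1) ^ k * p * S, ?_⟩
    linear_combination ((p : ℤ) ^ 2 - (k + 1) ^ 2) * ha - (-1) ^ k * (p : ℤ) ^ 2 * hb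

theorem dvd_sum_pow_sub_three (p h : ℕ) (hp : p.Prime) (h1 : 1 < h) (hph : p = 2 * h + 1) :
    (p : ℤ) ∣ ∑ j ∈ range h, ((j : ℤ) + 1) ^ (p - 3) := by
  have : Fact p.Prime := ⟨hp⟩
  rw [← ZMod.intCast_zmod_eq_zero_iff_dvd]
  push_cast
  have key : ∑ j ∈ range (2 * h), ((j : ZMod p) + 1) ^ (p - 3) = 0 := by
    have h2 : ∑ x : ZMod p, x ^ (p - 3) = 0 :=
      FiniteField.sum_pow_lt_card_sub_one (ZMod p) _ (by rw [ZMod.card]; omega)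
    have h3 : ∑ j ∈ range p, (j : ZMod p) ^ (p - 3) = ∑ x : ZMod p, x ^ (p - 3) := by
      refine sum_bij' (fun j _ => (j : ZMod p)) (fun x _ => x.val) ?_ ?_ ?_ ?_ ?_
      · simp
      · intro x _; exact mem_range.mpr (ZMod.val_lt x)
      · intro j hj; exact ZMod.val_cast_of_lt (mem_range.mp hj)
      · intro x _; exact ZMod.natCast_zmod_val x
      · simp
    rw [h2, show range p = range (2 * h + 1) by rw [hph], sum_range_succ'] at h3
    simpa [show p - 3 ≠ 0 by omega] using h3
  rw [two_mul, sum_range_add, ← sum_range_reflect (fun j => (((h + j : ℕ) : ZMod p) + 1) ^ (p - 3)),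
    ← sum_add_distrib] at key
  have h2 : (2 : ZMod p) ≠ 0 := by
    intro h
    have : ((2 : ℕ) : ZMod p) = 0 := by exact_mod_cast h
    rw [ZMod.natCast_eq_zero_iff] at this
    exact absurd (Nat.le_of_dvd (by omega) this) (by omega)
  refine (mul_eq_zero.mp ?_).resolve_left h2
  rw [← key, mul_sum]
  refine sum_congr rfl fun j hj => ?_
  have hj := mem_range.mp hj
  have he : (((h + (h - 1 - j) : ℕ) : ZMod p) + 1) = -((j : ZMod p) + 1) := by
    have h0 := ZMod.natCast_self p
    have : ((h + (h - 1 - j) : ℕ) + 1 + (j + 1) : ℕ) = p := by omega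
    have h4 := congrArg (fun i : ℕ => (i : ZMod p)) this
    simp only [h0] at h4
    push_cast at h4 ⊢
    linear_combination h4
  rw [he, Even.neg_pow ⟨h - 1, by omega⟩]
  ring

/-- For a prime `p > 3`,
`∑_{k=0}^{p-1} (2k+1) A_k(-1) ≡ (-1)^{(p-1)/2} p - p³ E_{p-3} (mod p⁴)`. -/
theorem sum_two_k_add_one_apery_neg_one (p : ℕ) (hp : p.Prime) (h3 : 3 < p) :
    ∑ k ∈ Finset.range p, (2 * (k : ℤ) + 1) * aperyPoly k (-1) ≡
      (-1) ^ ((p - 1) / 2) * (p : ℤ) - (p : ℤ) ^ 3 * eulerNumber (p - 3) [ZMOD (p : ℤ) ^ 4] := by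
  obtain ⟨h, hph⟩ : ∃ h, p = 2 * h + 1 := hp.odd_of_ne_two (by omega)
  have hh : (p - 1) / 2 = h := by omega
  have h1 : 1 < h := by omega
  have hp0 : (p : ℤ) ≠ 0 := by exact_mod_cast hp.ne_zero
  have hpz := Nat.prime_iff_prime_int.mp hp
  have hpc : (p : ℤ) = 2 * h + 1 := by exact_mod_cast hph
  rw [hh]
  set t : ℕ → ℤ := fun k => (-1) ^ k * ∑ n ∈ range p,
    (2 * (n : ℤ) + 1) * ((n.choose k : ℤ) ^ 2 * ((n + k).choose k : ℤ) ^ 2) with ht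
  set c : ℕ → ℤ := fun k => (p - 1).choose k * (p + k).choose k with hc
  have hsum : ∑ k ∈ range p, (2 * (k : ℤ) + 1) * aperyPoly k (-1) = ∑ k ∈ range p, t k := by
    have : ∀ n ∈ range p, (2 * (n : ℤ) + 1) * aperyPoly n (-1) =
        ∑ k ∈ range p, (-1) ^ k * ((2 * (n : ℤ) + 1) *
          ((n.choose k : ℤ) ^ 2 * ((n + k).choose k : ℤ) ^ 2)) := by
      intro n hn
      have hn := mem_range.mp hn
      rw [aperyPoly, sum_subset (s₂ := range p), mul_sum]
      · exact sum_congr rfl fun k _ => by ring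
      · exact range_subset_range.mpr hn
      · intro k _ hk
        rw [Nat.choose_eq_zero_of_lt (by simpa using hk)]
        simp
    rw [sum_congr rfl this, sum_comm]
    simp only [ht, mul_sum]
  have htc : ∀ k < p, (2 * (k : ℤ) + 1) * t k = (-1) ^ k * (p : ℤ) ^ 2 * c k ^ 2 := by
    intro k hk
    have e1 := two_mul_add_one_mul_sum_choose_sq p k
    have e2 := congrArg (· ^ 2) (sub_mul_choose_eq p k hk)
    simp only [ht, hc] at e2 ⊢
    linear_combination (-1) ^ k * e1 + (-1) ^ k * ((p + k).choose k : ℤ) ^ 2 * e2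
  have hsq : ∀ k : ℕ, ((-1 : ℤ) ^ k) ^ 2 = 1 := fun k => by rw [← pow_mul, pow_mul']; simp
  have hmid : (p : ℤ) ^ 4 ∣ t h - (-1) ^ h * p := by
    obtain ⟨a, ha⟩ := choose_mul_choose_modEq p h hp h3 (by omega)
    obtain ⟨b, hb⟩ := dvd_sum_pow_sub_three p h hp h1 hph
    have e := htc h (by omega)
    rw [hb] at ha
    have hc1 : c h = (-1) ^ h + (p : ℤ) ^ 3 * (a - (-1) ^ h * b) := by
      simp only [hc]
      linear_combination ha
    rw [← hpc, hc1] at e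
    have e' : t h = (-1) ^ h * p * ((-1) ^ h + (p : ℤ) ^ 3 * (a - (-1) ^ h * b)) ^ 2 :=
      mul_left_cancel₀ hp0 (by linear_combination e)
    refine ⟨(-1) ^ h * (2 * (-1) ^ h * (a - (-1) ^ h * b) +
      (p : ℤ) ^ 3 * (a - (-1) ^ h * b) ^ 2), ?_⟩
    rw [e']
    linear_combination (-1) ^ h * p * hsq h
  have hcsq : ∀ k < p, ∃ d, c k ^ 2 = 1 + (p : ℤ) ^ 2 * d := by
    intro k hk
    obtain ⟨a, ha⟩ := choose_mul_choose_modEq p k hp h3 hk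
    set S := ∑ j ∈ range k, ((j : ℤ) + 1) ^ (p - 3)
    have hc1 : c k = (-1) ^ k + (p : ℤ) ^ 2 * (p * a - (-1) ^ k * S) := by
      simp only [hc]
      linear_combination ha
    refine ⟨2 * (-1) ^ k * (p * a - (-1) ^ k * S) + (p : ℤ) ^ 2 * (p * a - (-1) ^ k * S) ^ 2, ?_⟩
    rw [hc1]
    linear_combination hsq k
  have hpair : ∀ k ∈ range h, (p : ℤ) ^ 4 ∣ (t k + t (p - 1 - k)) -
      (-(p : ℤ) ^ 3 * (2 * ((-1) ^ k * (2 * (k : ℤ) + 1) ^ (p - 3)))) := by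
    intro k hk
    have hk := mem_range.mp hk
    have hn : ¬ (p : ℤ) ∣ 2 * (k : ℤ) + 1 := by
      intro hd
      have : p ∣ 2 * k + 1 := by exact_mod_cast hd
      exact absurd (Nat.le_of_dvd (by omega) this) (by omega)
    have hn' : ¬ (p : ℤ) ∣ 2 * (p : ℤ) - (2 * (k : ℤ) + 1) := fun hd =>
      hn ((dvd_sub_right (Dvd.intro_left _ rfl)).mp hd)
    have hcop : IsCoprime ((p : ℤ) ^ 4) ((2 * (k : ℤ) + 1) * (2 * (p : ℤ) - (2 * (k : ℤ) + 1))) :=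
      ((hpz.coprime_iff_not_dvd.mpr hn).mul_right (hpz.coprime_iff_not_dvd.mpr hn')).pow_left
    refine hcop.dvd_of_dvd_mul_right ?_
    have e1 := htc k (by omega)
    have e2 := htc (p - 1 - k) (by omega)
    obtain ⟨d1, hd1⟩ := hcsq k (by omega)
    obtain ⟨d2, hd2⟩ := hcsq (p - 1 - k) (by omega)
    obtain ⟨b, hb⟩ := prime_dvd_pow_sub_one p hp _ hn
    rw [show p - 1 = p - 3 + 2 by omega, pow_add] at hb
    have hs : (-1 : ℤ) ^ (p - 1 - k) = (-1) ^ k := by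
      rw [show p - 1 - k = k + 2 * (h - k) by omega, pow_add, pow_mul]
      simp
    have hcast : ((p - 1 - k : ℕ) : ℤ) = p - 1 - k := by omega
    rw [hs, hd2, hcast] at e2
    rw [hd1] at e1
    set m : ℤ := 2 * (k : ℤ) + 1 with hm
    have e2' : (2 * (p : ℤ) - m) * t (p - 1 - k) = (-1) ^ k * p ^ 2 * (1 + p ^ 2 * d2) := by
      rw [← e2, hm]
      ring
    refine ⟨(-1) ^ k * ((2 * p - m) * d1 + m * d2 + 4 * m * m ^ (p - 3) - 2 * b), ?_⟩
    linear_combination (2 * (p : ℤ) - m) * e1 + m * e2' - 2 * (-1) ^ k * (p : ℤ) ^ 3 * hb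
  have hsplit : ∑ k ∈ range p, t k = t h + ∑ k ∈ range h, (t k + t (p - 1 - k)) := by
    have e : ∑ k ∈ range p, t k = ∑ k ∈ range (h + 1 + h), t k := by
      rw [hph]; congr 2; ring
    rw [e, sum_range_add, sum_range_succ, sum_add_distrib,
      ← sum_range_reflect (fun k => t (h + 1 + k))]
    have : ∀ j ∈ range h, t (h + 1 + (h - 1 - j)) = t (p - 1 - j) := by
      intro j hj
      have := mem_range.mp hj
      congr 1
      omega
    rw [sum_congr rfl this]
    ring
  have hS := dvd_sum hpair
  rw [sum_sub_distrib, ← mul_sum] at hS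
  obtain ⟨u, hu⟩ := hS
  obtain ⟨v, hv⟩ := hmid
  obtain ⟨w, hw⟩ := (two_mul_sum_neg_one_pow_mul_odd_pow_modEq p h h1 hph).dvd
  rw [hsum, hsplit]
  refine (Int.modEq_iff_dvd.mpr ⟨u + v + w, ?_⟩).symm
  linear_combination hu + hv + (p : ℤ) ^ 3 * hw
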